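/- arXiv:2605.05326 — 3 statements merged into one kernel-verified Lean document; each statement's English description precedes it below -/
import Mathlib

section
/- Let Σ ⊆ M be a slice, let a₁, a₂ ⊆ Σ be hypersurfaces, set a = a₁ ∪ a₂, and let p ∈ edge(a₁) \ closure(I(a₂ \ a₁)). Let O be an open neighborhood of p with closure(O) ∩ closure(I(a₂ \ a₁)) = ∅, and let b be a past directed outward null deformation of a within O. Then b' = b \ closure(a₂ \ a₁) is a past directed outward null deformation of a₁ within O. (The geometric core of the proof of the paper's Lemma 'Locality of entropy normality'.) -/
open Set Metric

noncomputable section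

/-- Spatial Euclidean factor. -/
abbrev E (n : ℕ) : Type := EuclideanSpace ℝ (Fin n)

/-- Minkowski spacetime `M = ℝ × E`. -/
abbrev M (n : ℕ) : Type := ℝ × E n

variable {n : ℕ}

/-- Chronological relation `p ≪ q`. -/
def chron (p q : M n) : Prop := dist p.2 q.2 < q.1 - p.1

/-- Causal relation `p ≼ q`. -/
def causal (p q : M n) : Prop := dist p.2 q.2 ≤ q.1 - p.1

/-- Chronological future `I⁺(S)`. -/
def Iplus (S : Set (M n)) : Set (M n) := {q | ∃ p ∈ S, chron p q}

/-- Chronological past `I⁻(S)`. -/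
def Iminus (S : Set (M n)) : Set (M n) := {q | ∃ p ∈ S, chron q p}

/-- `I(S) = I⁺(S) ∪ I⁻(S)`. -/
def Iboth (S : Set (M n)) : Set (M n) := Iplus S ∪ Iminus S

/-- Causal future `J⁺(S)`. -/
def Jplus (S : Set (M n)) : Set (M n) := {q | ∃ p ∈ S, causal p q}

/-- Causal past `J⁻(S)`. -/
def Jminus (S : Set (M n)) : Set (M n) := {q | ∃ p ∈ S, causal q p}

/-- A set is achronal if no two of its points are chronologically related. -/
def Achronal (S : Set (M n)) : Prop := ∀ p ∈ S, ∀ q ∈ S, ¬ chron p q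

/-- A set is acausal if no two distinct points of it are causally related. -/
def Acausal (S : Set (M n)) : Prop := ∀ p ∈ S, ∀ q ∈ S, p ≠ q → ¬ causal p q

/-- `edge(a)`: points `p ∈ closure a` such that every open neighborhood `O` of `p`
contains `q, r` with `r ≪ p ≪ q` together with a continuous timelike curve in `O`
from `r` to `q` avoiding `a`. -/
def edge (a : Set (M n)) : Set (M n) :=
  {p | p ∈ closure a ∧ ∀ O : Set (M n), IsOpen O → p ∈ O →
    ∃ q ∈ O, ∃ r ∈ O, chron r p ∧ chron p q ∧
      ∃ γ : ℝ → M n, ContinuousOn γ (Icc 0 1) ∧ γ 0 = r ∧ γ 1 = q ∧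
        (∀ s ∈ Icc (0:ℝ) 1, γ s ∈ O ∧ γ s ∉ a) ∧
        (∀ s ∈ Icc (0:ℝ) 1, ∀ t ∈ Icc (0:ℝ) 1, s < t → chron (γ s) (γ t))}

/-- A slice: a closed achronal set with empty edge. -/
def IsSlice (Sg : Set (M n)) : Prop := IsClosed Sg ∧ Achronal Sg ∧ edge Sg = ∅

/-- A hypersurface in the slice `Sg`: a subset open in the subspace topology of `Sg`. -/
def IsHypersurfaceIn (Sg a : Set (M n)) : Prop :=
  a ⊆ Sg ∧ IsOpen ((Subtype.val : Sg → M n) ⁻¹' a)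

/-- A hypersurface: subset of some slice, open in the slice's subspace topology. -/
def IsHypersurface (a : Set (M n)) : Prop := ∃ Sg, IsSlice Sg ∧ IsHypersurfaceIn Sg a

/-- The frontier (boundary) of `a` in the subspace topology of `Sg`,
viewed as a subset of spacetime. -/
def frontierIn (Sg a : Set (M n)) : Set (M n) :=
  (Subtype.val : Sg → M n) '' frontier ((Subtype.val : Sg → M n) ⁻¹' a)

/-- A future-infinite causal worldline: the graph `{(t, x t) : t ≥ t₀}` of a
1-Lipschitz map defined on `[t₀, ∞)`. -/
def IsWorldline (W : Set (M n)) : Prop :=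
  ∃ t₀ : ℝ, ∃ x : ℝ → E n, LipschitzOnWith 1 x (Ici t₀) ∧
    W = {p : M n | t₀ ≤ p.1 ∧ p.2 = x p.1}

/-- Domain of dependence `D(S)`: points through which every inextendible causal
curve (graph of a 1-Lipschitz map `ℝ → E`) meets `S`. -/
def Dom (S : Set (M n)) : Set (M n) :=
  {p | ∀ x : ℝ → E n, LipschitzWith 1 x → x p.1 = p.2 → ∃ t : ℝ, (t, x t) ∈ S}

/-- Future domain of dependence `D⁺(S)`: every inextendible causal curve through `p`
meets `S` at some time `t ≤ p.1`. -/
def DomPlus (S : Set (M n)) : Set (M n) :=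
  {p | ∀ x : ℝ → E n, LipschitzWith 1 x → x p.1 = p.2 →
    ∃ t : ℝ, t ≤ p.1 ∧ (t, x t) ∈ S}

/-- A `C¹` function has timelike gradient if at every point `∂T/∂t > ‖∇_E T‖`. -/
def TimelikeGrad (T : M n → ℝ) : Prop :=
  ∀ p : M n,
    ‖(fderiv ℝ T p).comp (ContinuousLinearMap.inr ℝ ℝ (E n))‖ <
      fderiv ℝ T p ((1 : ℝ), (0 : E n))

/-- A past directed outward null deformation of the hypersurface `a` within the
open set `O`. -/
def IsPastOutwardNullDeformation (a O b : Set (M n)) : Prop :=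
  IsHypersurface b ∧ Dom a ⊆ Dom b ∧ b ⊆ closure (Iminus a) ∧
  symmDiff a b ⊆ O ∧ edge b ⊆ edge a ∪ ((frontier (Iminus a) \ a) ∩ O)


theorem chron_of_causal_of_lt {x y : M n} (h : causal x y) {ε : ℝ} (hε : 0 < ε) :
    chron x (y.1 + ε, y.2) := by
  simp only [causal, chron] at *
  linarith

theorem chron_of_lt_of_causal {x y : M n} (h : causal x y) {ε : ℝ} (hε : 0 < ε) :
    chron (x.1 - ε, x.2) y := by
  simp only [causal, chron] at *
  linarith

theorem isOpen_setOf_chron_left (q : M n) : IsOpen {p : M n | chron p q} :=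
  isOpen_lt (by fun_prop) (by fun_prop)

theorem isOpen_setOf_chron_right (p : M n) : IsOpen {q : M n | chron p q} :=
  isOpen_lt (by fun_prop) (by fun_prop)

theorem mem_closure_of_forall_time_shift {S : Set (M n)} {y : M n} (c : ℝ)
    (h : ∀ ε : ℝ, 0 < ε → (y.1 + c * ε, y.2) ∈ S) : y ∈ closure S := by
  have hc : Filter.Tendsto (fun ε : ℝ => ((y.1 + c * ε, y.2) : M n))
      (nhdsWithin 0 (Ioi 0)) (nhds y) := by
    have : Continuous (fun ε : ℝ => ((y.1 + c * ε, y.2) : M n)) := by fun_prop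
    simpa using (this.tendsto 0).mono_left nhdsWithin_le_nhds
  exact mem_closure_of_tendsto hc
    (Filter.eventually_of_mem self_mem_nhdsWithin fun ε hε => h ε hε)

theorem Jplus_closure_subset (S : Set (M n)) : Jplus (closure S) ⊆ closure (Iplus S) := by
  rintro y ⟨x, hx, hxy⟩
  refine mem_closure_of_forall_time_shift 1 fun ε hε => ?_
  rw [one_mul]
  obtain ⟨z, hz, hzS⟩ := mem_closure_iff.1 hx _ (isOpen_setOf_chron_left _)
    (chron_of_causal_of_lt hxy hε)
  exact ⟨z, hzS, hz⟩

theorem Jminus_closure_subset (S : Set (M n)) : Jminus (closure S) ⊆ closure (Iminus S) := by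
  rintro y ⟨x, hx, hxy⟩
  refine mem_closure_of_forall_time_shift (-1) fun ε hε => ?_
  rw [neg_one_mul, ← sub_eq_add_neg]
  obtain ⟨z, hz, hzS⟩ := mem_closure_iff.1 hx _ (isOpen_setOf_chron_right _)
    (chron_of_lt_of_causal hxy hε)
  exact ⟨z, hzS, hz⟩

theorem subset_closure_Iminus (S : Set (M n)) : S ⊆ closure (Iminus S) := fun x hx =>
  Jminus_closure_subset S ⟨x, subset_closure hx, by simp [causal]⟩

theorem closure_Iminus_subset (S : Set (M n)) : closure (Iminus S) ⊆ closure (Iboth S) :=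
  closure_mono subset_union_right

theorem closure_Iplus_subset (S : Set (M n)) : closure (Iplus S) ⊆ closure (Iboth S) :=
  closure_mono subset_union_left

theorem closure_subset_closure_Iboth (S : Set (M n)) : closure S ⊆ closure (Iboth S) :=
  (closure_minimal (subset_closure_Iminus S) isClosed_closure).trans (closure_Iminus_subset S)

theorem Iminus_union (S T : Set (M n)) : Iminus (S ∪ T) = Iminus S ∪ Iminus T := by
  ext x
  simp only [Iminus, mem_union, mem_ofPred_eq, or_and_right, exists_or]

/-- Any two points of a causal curve are causally related, so a causal curve through the closure
of `S` stays in the closure of `I(S)`. -/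
theorem curve_mem_closure_Iboth {S : Set (M n)} {x : ℝ → E n} (hx : LipschitzWith 1 x) {s : ℝ}
    (hs : (s, x s) ∈ closure S) (t : ℝ) : (t, x t) ∈ closure (Iboth S) := by
  have hd := hx.dist_le_mul
  simp only [NNReal.coe_one, one_mul, Real.dist_eq] at hd
  rcases le_total s t with h | h
  · refine closure_Iplus_subset S (Jplus_closure_subset S ⟨_, hs, ?_⟩)
    have := hd s t
    rwa [abs_of_nonpos (by linarith), neg_sub] at this
  · refine closure_Iminus_subset S (Jminus_closure_subset S ⟨_, hs, ?_⟩)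
    have := hd t s
    rwa [abs_of_nonpos (by linarith), neg_sub] at this

/-- Membership in the edge is a local property. -/
theorem edge_congr {S T N : Set (M n)} {y : M n} (hN : IsOpen N) (hy : y ∈ N)
    (h : ∀ z ∈ N, z ∈ S ↔ z ∈ T) (hyS : y ∈ edge S) : y ∈ edge T := by
  obtain ⟨hcl, he⟩ := hyS
  refine ⟨mem_closure_iff.2 fun U hU hyU => ?_, fun U hU hyU => ?_⟩
  · obtain ⟨z, ⟨hzU, hzN⟩, hzS⟩ := mem_closure_iff.1 hcl (U ∩ N) (hU.inter hN) ⟨hyU, hy⟩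
    exact ⟨z, hzU, (h z hzN).1 hzS⟩
  · obtain ⟨q, hq, r, hr, hrp, hpq, γ, hγ, h0, h1, hav, hmono⟩ :=
      he (U ∩ N) (hU.inter hN) ⟨hyU, hy⟩
    exact ⟨q, hq.1, r, hr.1, hrp, hpq, γ, hγ, h0, h1, fun s hs =>
      ⟨(hav s hs).1.1, fun hT => (hav s hs).2 ((h _ (hav s hs).1.2).2 hT)⟩, hmono⟩

theorem mem_frontier_congr {X : Type*} [TopologicalSpace X] {S T N : Set X} {y : X}
    (hN : IsOpen N) (hy : y ∈ N) (h : ∀ z ∈ N, z ∈ S ↔ z ∈ T) (hyS : y ∈ frontier S) :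
    y ∈ frontier T := by
  have key : ∀ {A B : Set X}, (∀ z ∈ N, z ∈ A → z ∈ B) → y ∈ closure A → y ∈ closure B := by
    intro A B hAB hA
    refine mem_closure_iff.2 fun U hU hyU => ?_
    obtain ⟨z, ⟨hzU, hzN⟩, hzA⟩ := mem_closure_iff.1 hA (U ∩ N) (hU.inter hN) ⟨hyU, hy⟩
    exact ⟨z, hzU, hAB z hzN hzA⟩
  rw [frontier_eq_closure_inter_closure] at hyS ⊢
  exact ⟨key (fun z hz => (h z hz).1) hyS.1,
    key (A := Sᶜ) (B := Tᶜ) (fun z hz hzS hzT => hzS ((h z hz).2 hzT)) hyS.2⟩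

theorem IsHypersurfaceIn.diff_isClosed {Sg b K : Set (M n)} (h : IsHypersurfaceIn Sg b)
    (hK : IsClosed K) : IsHypersurfaceIn Sg (b \ K) :=
  ⟨sdiff_subset.trans h.1, by
    rw [preimage_sdiff]
    exact h.2.sdiff (hK.preimage continuous_subtype_val)⟩

theorem IsHypersurfaceIn.disjoint_closure_diff {Sg a c : Set (M n)} (h : IsHypersurfaceIn Sg a)
    (hc : c ⊆ Sg) : Disjoint a (closure (c \ a)) := by
  obtain ⟨U, hU, hUa⟩ := isOpen_induced_iff.1 h.2
  have hmem : ∀ z (hz : z ∈ Sg), z ∈ U ↔ z ∈ a := fun z hz => Set.ext_iff.1 hUa ⟨z, hz⟩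
  refine Set.disjoint_left.2 fun z hz hcl => ?_
  obtain ⟨w, hwU, hw⟩ := mem_closure_iff.1 hcl U hU ((hmem z (h.1 hz)).2 hz)
  exact hw.2 ((hmem w (hc hw.1)).1 hwU)

/-- If `b` is a past directed outward null deformation of
`a = a₁ ∪ a₂` within `O`, where `O` is a neighborhood of
`p ∈ edge(a₁) \\ closure(I(a₂ \\ a₁))` with
`closure(O) ∩ closure(I(a₂ \\ a₁)) = ∅`, then `b \\ closure(a₂ \\ a₁)` is a
past directed outward null deformation of `a₁` within `O`. -/
theorem stmt9 {n : ℕ} (hn : 0 < n) (Sg a₁ a₂ O b : Set (M n))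
    (hSg : IsSlice Sg)
    (h1 : IsHypersurfaceIn Sg a₁) (h2 : IsHypersurfaceIn Sg a₂)
    (p : M n) (hp : p ∈ edge a₁ \ closure (Iboth (a₂ \ a₁)))
    (hO : IsOpen O) (hpO : p ∈ O)
    (hOcl : closure O ∩ closure (Iboth (a₂ \ a₁)) = ∅)
    (hb : IsPastOutwardNullDeformation (a₁ ∪ a₂) O b) :
    IsPastOutwardNullDeformation a₁ O (b \ closure (a₂ \ a₁)) := by
  obtain ⟨⟨Sb, hSb, hbS⟩, hDom, hcl, hsymm, hedge⟩ := hb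
  have haK : ∀ z ∈ a₁, z ∉ closure (a₂ \ a₁) := fun z hz =>
    Set.disjoint_left.1 (h1.disjoint_closure_diff h2.1) hz
  have hdK : ∀ z ∈ a₂, z ∉ a₁ → z ∈ closure (a₂ \ a₁) := fun z hz hz' => subset_closure ⟨hz, hz'⟩
  have hclOI : ∀ z ∈ closure O, z ∉ closure (Iboth (a₂ \ a₁)) := fun z hz hz' =>
    (Set.ext_iff.1 hOcl z).1 ⟨hz, hz'⟩
  have hOI : ∀ z ∈ O, z ∉ closure (Iboth (a₂ \ a₁)) := fun z hz => hclOI z (subset_closure hz)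
  have hKI := closure_subset_closure_Iboth (a₂ \ a₁)
  have hab : ∀ z, z ∉ O → (z ∈ a₁ ∪ a₂ ↔ z ∈ b) := fun z hz => by
    have hn := fun h => hz (@hsymm z h)
    rw [Set.mem_symmDiff] at hn
    exact ⟨fun h => by_contra fun h' => hn (Or.inl ⟨h, h'⟩),
      fun h => by_contra fun h' => hn (Or.inr ⟨h, h'⟩)⟩
  have ha : ∀ z, z ∉ closure (a₂ \ a₁) → (z ∈ a₁ ∪ a₂ ↔ z ∈ a₁) := fun z hz =>
    ⟨fun h => by_contra fun h' => hz (hdK z (h.resolve_left h') h'), Or.inl⟩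
  refine ⟨⟨Sb, hSb, hbS.diff_isClosed isClosed_closure⟩, ?_, ?_, ?_, ?_⟩
  · intro q hq x hx hxq
    obtain ⟨t, ht⟩ := hq x hx hxq
    obtain ⟨s, hs⟩ := hDom (fun y hy hyq => (hq y hy hyq).imp fun _ => Or.inl) x hx hxq
    by_cases hsK : (s, x s) ∈ closure (a₂ \ a₁)
    · have htO : (t, x t) ∉ O := fun h => hOI _ h (curve_mem_closure_Iboth hx hsK t)
      exact ⟨t, (hab _ htO).1 (Or.inl ht), haK _ ht⟩
    · exact ⟨s, hs, hsK⟩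
  · rintro y ⟨hyb, hyK⟩
    by_cases hyO : y ∈ O
    · have hunion : a₁ ∪ a₂ = a₁ ∪ (a₂ \ a₁) := union_sdiff_self.symm
      have hy := hcl hyb
      rw [hunion, Iminus_union, closure_union] at hy
      exact hy.resolve_right fun h => hOI y hyO (closure_Iminus_subset _ h)
    · exact subset_closure_Iminus _ ((ha y hyK).1 ((hab y hyO).2 hyb))
  · intro y hy
    by_contra hyO
    rcases hy with ⟨hya, hyb⟩ | ⟨⟨hyb, hyK⟩, hya⟩
    · exact hyb ⟨(hab y hyO).1 (Or.inl hya), haK y hya⟩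
    · exact hya ((ha y hyK).1 ((hab y hyO).2 hyb))
  · intro y hy
    by_cases hyK : y ∈ closure (a₂ \ a₁)
    · refine Or.inl (edge_congr (N := (closure O)ᶜ) isClosed_closure.isOpen_compl
        (fun h => hclOI y h (hKI hyK)) (fun z hz => ?_) hy)
      have hzb := hab z fun h => hz (subset_closure h)
      exact ⟨fun h => (ha z h.2).1 (hzb.2 h.1), fun h => ⟨hzb.1 (Or.inl h), haK z h⟩⟩
    · have hyb : y ∈ edge b := edge_congr (N := (closure (a₂ \ a₁))ᶜ)
        isClosed_closure.isOpen_compl hyK (fun z hz => and_iff_left hz) hy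
      rcases hedge hyb with hya | ⟨⟨hyf, hya⟩, hyO⟩
      · exact Or.inl (edge_congr isClosed_closure.isOpen_compl hyK ha hya)
      · refine Or.inr ⟨⟨mem_frontier_congr hO hyO (fun z hz => ?_) hyf,
          fun h => hya (Or.inl h)⟩, hyO⟩
        rw [← union_sdiff_self, Iminus_union]
        exact or_iff_left fun h => hOI z hz (closure_Iminus_subset _ (subset_closure h))

end
end

section
/- Let T : M → ℝ be a smooth function with timelike gradient and set Σ = T⁻¹(0). Let p ∈ M and ℓ > ℓ' > 0 be such that the closed ball of radius ℓ centered at p (in the product metric on ℝ × E) is contained in D(Σ). Then there exists a smooth function T' : M → ℝ with timelike gradient such that, writing Σ' = T'⁻¹(0): T' ≤ T everywhere; T' = T outside the open ball B(p, ℓ) (hence the symmetric difference Σ Δ Σ' is contained in B(p, ℓ)); Σ' ∩ Σ ∩ B(p, ℓ') = ∅; Σ' ∩ I⁻(Σ) = ∅; and D(Σ') = D(Σ). (Minkowski-spacetime instance of the paper's local timeslice-deformation Lemma.) -/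
open Set Metric

noncomputable section

variable {n : ℕ}

lemma TimelikeGrad.fderiv_pos {T : M n → ℝ} (hTg : TimelikeGrad T) (q v : M n)
    (hv : ‖v.2‖ ≤ v.1) (hv0 : 0 < v.1) : 0 < fderiv ℝ T q v := by
  have hsplit : fderiv ℝ T q v = v.1 * fderiv ℝ T q ((1 : ℝ), (0 : E n)) +
      (fderiv ℝ T q).comp (ContinuousLinearMap.inr ℝ ℝ (E n)) v.2 := by
    have h : v = v.1 • ((1 : ℝ), (0 : E n)) + ContinuousLinearMap.inr ℝ ℝ (E n) v.2 := by
      ext <;> simp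
    conv_lhs => rw [h]
    rw [map_add, map_smul, smul_eq_mul, ContinuousLinearMap.comp_apply]
  have hle := ((fderiv ℝ T q).comp (ContinuousLinearMap.inr ℝ ℝ (E n))).le_opNorm v.2
  rw [Real.norm_eq_abs] at hle
  have habs := (abs_le.mp hle).1
  have hmul := mul_le_mul_of_nonneg_left hv
    (norm_nonneg ((fderiv ℝ T q).comp (ContinuousLinearMap.inr ℝ ℝ (E n))))
  have hlt := mul_lt_mul_of_pos_right (hTg q) hv0
  linarith

/-- A differentiable function with timelike gradient is strictly increasing to the causal
future. -/
lemma TimelikeGrad.lt_of_causal {T : M n → ℝ} (hT : Differentiable ℝ T) (hTg : TimelikeGrad T)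
    {a b : M n} (hab : causal a b) (hlt : a.1 < b.1) : T a < T b := by
  have hd : ∀ s : ℝ, HasDerivAt (fun s : ℝ => T (a + s • (b - a)))
      (fderiv ℝ T (a + s • (b - a)) (b - a)) s := by
    intro s
    have hline : HasDerivAt (fun s : ℝ => a + s • (b - a)) (b - a) s := by
      simpa using ((hasDerivAt_id s).smul_const (b - a)).const_add a
    exact (hT _).hasFDerivAt.comp_hasDerivAt s hline
  have hmono : StrictMono fun s : ℝ => T (a + s • (b - a)) := by
    refine strictMono_of_deriv_pos fun s => ?_
    rw [(hd s).deriv]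
    refine hTg.fderiv_pos _ _ ?_ (by simpa using hlt)
    have h : dist a.2 b.2 ≤ b.1 - a.1 := hab
    rw [dist_comm, dist_eq_norm] at h
    simpa using h
  simpa using hmono (zero_lt_one' ℝ)

/-- A smooth perturbation supported in a compact set can be scaled down so that it preserves
timelikeness of the gradient. -/
lemma TimelikeGrad.exists_sub_smul {T φ : M n → ℝ} (hT : ContDiff ℝ (⊤ : ℕ∞) T)
    (hTg : TimelikeGrad T) (hφ : ContDiff ℝ (⊤ : ℕ∞) φ) (hc : HasCompactSupport φ) :
    ∃ ε : ℝ, 0 < ε ∧ TimelikeGrad fun q => T q - ε * φ q := by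
  have hTc : Continuous (fderiv ℝ T) := hT.continuous_fderiv (by simp)
  have hφc : Continuous (fderiv ℝ φ) := hφ.continuous_fderiv (by simp)
  obtain ⟨C, hC⟩ := (hc.fderiv (𝕜 := ℝ)).exists_bound_of_continuous hφc
  have hC0 : 0 ≤ C := (norm_nonneg _).trans (hC 0)
  obtain ⟨m, hm, hmle⟩ : ∃ m : ℝ, 0 < m ∧ ∀ q ∈ tsupport φ,
      m ≤ fderiv ℝ T q ((1 : ℝ), (0 : E n)) -
        ‖(fderiv ℝ T q).comp (ContinuousLinearMap.inr ℝ ℝ (E n))‖ := by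
    refine IsCompact.exists_forall_le' hc.isCompact (Continuous.continuousOn ?_)
      fun q _ => sub_pos.mpr (hTg q)
    exact (hTc.clm_apply continuous_const).sub (hTc.clm_comp continuous_const).norm
  have hden : 0 < 2 * C + 1 := by linarith
  refine ⟨m / (2 * C + 1), div_pos hm hden, fun q => ?_⟩
  set ε := m / (2 * C + 1) with hε
  have hεpos : 0 < ε := div_pos hm hden
  have hεm : ε * (2 * C + 1) = m := by rw [hε]; field_simp
  have hTd : DifferentiableAt ℝ T q := hT.differentiable (by simp) q
  have hφd : DifferentiableAt ℝ φ q := hφ.differentiable (by simp) q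
  have hder : fderiv ℝ (fun q => T q - ε * φ q) q = fderiv ℝ T q - ε • fderiv ℝ φ q :=
    (hTd.hasFDerivAt.sub (hφd.hasFDerivAt.const_mul ε)).fderiv
  rw [hder]
  by_cases hq : q ∈ tsupport φ
  · have hspace : ‖(fderiv ℝ φ q).comp (ContinuousLinearMap.inr ℝ ℝ (E n))‖ ≤ C := by
      refine ContinuousLinearMap.opNorm_le_bound _ hC0 fun v => ?_
      refine ((fderiv ℝ φ q).le_opNorm _).trans ?_
      have hv : ‖ContinuousLinearMap.inr ℝ ℝ (E n) v‖ = ‖v‖ := by simp [Prod.norm_def]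
      exact mul_le_mul (hC q) hv.le (norm_nonneg _) hC0
    have htime : fderiv ℝ φ q ((1 : ℝ), (0 : E n)) ≤ C := by
      have h := (fderiv ℝ φ q).le_opNorm ((1 : ℝ), (0 : E n))
      have hone : ‖((1 : ℝ), (0 : E n))‖ = 1 := by simp [Prod.norm_def]
      rw [hone, mul_one] at h
      exact (le_abs_self _).trans (h.trans (hC q))
    have hsub : ‖(fderiv ℝ T q - ε • fderiv ℝ φ q).comp (ContinuousLinearMap.inr ℝ ℝ (E n))‖ ≤
        ‖(fderiv ℝ T q).comp (ContinuousLinearMap.inr ℝ ℝ (E n))‖ + ε * C := by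
      rw [ContinuousLinearMap.sub_comp, ContinuousLinearMap.smul_comp]
      refine (norm_sub_le _ _).trans ?_
      rw [norm_smul, Real.norm_of_nonneg hεpos.le]
      gcongr
    have hm' := hmle q hq
    have ht := mul_le_mul_of_nonneg_left htime hεpos.le
    simp only [sub_apply, smul_apply, smul_eq_mul]
    linarith
  · rw [fderiv_of_notMem_tsupport (𝕜 := ℝ) hq, smul_zero, sub_zero]
    exact hTg q

/-- Local timeslice deformation near a point `p`, supported in
`B(p, ℓ) ⊆ D(Σ)`, pushing `Σ = T⁻¹(0)` off itself in `B(p, ℓ')` while preserving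
the domain of dependence. -/
theorem stmt11 {n : ℕ} (hn : 0 < n) (T : M n → ℝ)
    (hT : ContDiff ℝ (⊤ : ℕ∞) T) (hTg : TimelikeGrad T)
    (p : M n) (ℓ ℓ' : ℝ) (hpos : 0 < ℓ') (hlt : ℓ' < ℓ)
    (hball : Metric.closedBall p ℓ ⊆ Dom (T ⁻¹' {0})) :
    ∃ T' : M n → ℝ, ContDiff ℝ (⊤ : ℕ∞) T' ∧ TimelikeGrad T' ∧
      (∀ q, T' q ≤ T q) ∧
      (∀ q ∉ Metric.ball p ℓ, T' q = T q) ∧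
      T' ⁻¹' {0} ∩ T ⁻¹' {0} ∩ Metric.ball p ℓ' = ∅ ∧
      T' ⁻¹' {0} ∩ Iminus (T ⁻¹' {0}) = ∅ ∧
      Dom (T' ⁻¹' {0}) = Dom (T ⁻¹' {0}) := by
  let φ : ContDiffBump p := ⟨ℓ', (ℓ' + ℓ) / 2, hpos, by linarith⟩
  have hφ : ContDiff ℝ (⊤ : ℕ∞) φ := φ.contDiff
  have hTdiff : Differentiable ℝ T := hT.differentiable (by simp)
  obtain ⟨ε, hε, hgrad⟩ := hTg.exists_sub_smul hT hφ φ.hasCompactSupport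
  have hT' : ContDiff ℝ (⊤ : ℕ∞) fun q => T q - ε * φ q := hT.sub (contDiff_const.mul hφ)
  have hle : ∀ q, T q - ε * φ q ≤ T q := fun q =>
    sub_le_self _ (mul_nonneg hε.le φ.nonneg)
  have hout : ∀ q ∉ Metric.ball p ℓ, T q - ε * φ q = T q := by
    intro q hq
    rw [Metric.mem_ball, not_lt] at hq
    have h0 : φ q = 0 := φ.zero_of_le_dist (by change (ℓ' + ℓ) / 2 ≤ dist q p; linarith)
    rw [h0, mul_zero, sub_zero]
  refine ⟨fun q => T q - ε * φ q, hT', hgrad, hle, hout, ?_, ?_, ?_⟩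
  · refine Set.eq_empty_of_forall_notMem ?_
    rintro q ⟨⟨h1, h2⟩, h3⟩
    have h1 : T q - ε * φ q = 0 := h1
    have h2 : T q = 0 := h2
    have h4 : φ q = 1 := φ.one_of_mem_closedBall (Metric.ball_subset_closedBall h3)
    rw [h2, h4] at h1
    linarith
  · refine Set.eq_empty_of_forall_notMem ?_
    rintro q ⟨h1, s, hs, hqs⟩
    have h1 : T q - ε * φ q = 0 := h1
    have hs : T s = 0 := hs
    have hqs : dist q.2 s.2 < s.1 - q.1 := hqs
    have h := hTg.lt_of_causal hTdiff (a := q) (b := s) hqs.le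
      (by linarith [dist_nonneg (x := q.2) (y := s.2)])
    linarith [hle q]
  · refine Set.Subset.antisymm (fun q hq x hx hxq => ?_) (fun q hq x hx hxq => ?_)
    · obtain ⟨t, ht⟩ := hq x hx hxq
      by_cases hb : (t, x t) ∈ Metric.ball p ℓ
      · exact hball (Metric.ball_subset_closedBall hb) x hx rfl
      · exact ⟨t, (hout _ hb).symm.trans ht⟩
    · obtain ⟨t, ht⟩ := hq x hx hxq
      have ht : T (t, x t) = 0 := ht
      let u := max (t + 1) (p.1 + ℓ)
      have htu : t < u := (lt_add_one t).trans_le (le_max_left _ _)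
      have hu : (u, x u) ∉ Metric.ball p ℓ := by
        rw [Metric.mem_ball, not_lt, Prod.dist_eq]
        refine le_trans ?_ (le_max_left _ _)
        refine le_trans ?_ (le_abs_self (u - p.1))
        linarith [le_max_right (t + 1) (p.1 + ℓ)]
      have hcausal : causal (t, x t) (u, x u) := by
        have h := hx.dist_le_mul t u
        rw [NNReal.coe_one, one_mul, dist_comm t u, Real.dist_eq,
          abs_of_pos (sub_pos.mpr htu)] at h
        exact h
      have hpos_u := hTg.lt_of_causal hTdiff hcausal htu
      have hcont : Continuous fun s : ℝ => T (s, x s) - ε * φ (s, x s) :=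
        hT'.continuous.comp (continuous_id.prodMk hx.continuous)
      obtain ⟨s, -, hs⟩ := intermediate_value_Icc htu.le hcont.continuousOn
        (show (0 : ℝ) ∈ Icc _ _ from
          ⟨(hle _).trans ht.le, by rw [hout _ hu]; exact (ht ▸ hpos_u).le⟩)
      exact ⟨s, hs⟩

end
end

section
/- Let T : M → ℝ be a smooth function with timelike gradient, set Σ = T⁻¹(0), let X ⊆ Σ be compact, and let U ⊇ X be open. Then there exists a smooth function T' : M → ℝ with timelike gradient such that, writing Σ' = T'⁻¹(0): T' ≤ T everywhere; T' = T outside U; Σ' ∩ I⁻(Σ) = ∅; D(Σ') = D(Σ); and Σ' ∩ Σ ∩ X = ∅. (Minkowski-spacetime instance of the paper's Proposition 'Timeslices can be deformed'.) -/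
open Set Metric

noncomputable section

variable {n : ℕ}

/-- A differentiable function with timelike gradient is strictly increasing along
the causal relation. -/
theorem TimelikeGrad.lt_of_causal_s12 {T : M n → ℝ} (hTg : TimelikeGrad T)
    (hT : Differentiable ℝ T) {p q : M n} (hpq : causal p q) (ht : p.1 < q.1) :
    T p < T q := by
  have hline : ∀ s : ℝ, HasDerivAt (fun s : ℝ => T (p + s • (q - p)))
      (fderiv ℝ T (p + s • (q - p)) (q - p)) s := by
    intro s
    have h1 : HasDerivAt (fun s : ℝ => p + s • (q - p)) (q - p) s := by
      simpa using ((hasDerivAt_id s).smul_const (q - p)).const_add p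
    exact (hT (p + s • (q - p))).hasFDerivAt.comp_hasDerivAt s h1
  have hmono : StrictMono (fun s : ℝ => T (p + s • (q - p))) := by
    refine strictMono_of_deriv_pos fun s => ?_
    rw [(hline s).deriv]
    set r := p + s • (q - p)
    have hdec : q - p = (q.1 - p.1) • ((1 : ℝ), (0 : E n))
        + ContinuousLinearMap.inr ℝ ℝ (E n) (q.2 - p.2) := by
      ext <;> simp
    have hspace := ((fderiv ℝ T r).comp
      (ContinuousLinearMap.inr ℝ ℝ (E n))).le_opNorm (q.2 - p.2)
    have hdist : ‖q.2 - p.2‖ ≤ q.1 - p.1 := by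
      rw [← dist_eq_norm, dist_comm]; exact hpq
    have hg := hTg r
    rw [hdec, map_add, map_smul, smul_eq_mul]
    rw [ContinuousLinearMap.comp_apply, Real.norm_eq_abs] at hspace
    have habs := neg_abs_le (fderiv ℝ T r (ContinuousLinearMap.inr ℝ ℝ (E n) (q.2 - p.2)))
    have h2 := mul_le_mul_of_nonneg_left hdist
      (norm_nonneg ((fderiv ℝ T r).comp (ContinuousLinearMap.inr ℝ ℝ (E n))))
    have h3 := mul_lt_mul_of_pos_right hg (sub_pos.2 ht)
    linarith
  simpa using hmono zero_lt_one

/-- A differentiable function with timelike gradient is strictly increasing along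
inextendible causal curves. -/
theorem TimelikeGrad.strictMono_curve {T : M n → ℝ} (hTg : TimelikeGrad T)
    (hT : Differentiable ℝ T) {x : ℝ → E n} (hx : LipschitzWith 1 x) :
    StrictMono (fun t => T (t, x t)) := by
  intro s t hst
  refine hTg.lt_of_causal_s12 hT (p := (s, x s)) (q := (t, x t)) ?_ hst
  have h := hx.dist_le_mul s t
  rw [Real.dist_eq, abs_sub_comm, abs_of_pos (sub_pos.2 hst)] at h
  simpa [causal] using h

/-- If `T' ≤ T` have timelike gradients and agree outside a compact set, then every
inextendible causal curve meets both zero sets or neither. -/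
theorem exists_curve_mem_zero_iff {T T' : M n → ℝ} (hTg : TimelikeGrad T)
    (hT : Differentiable ℝ T) (hTg' : TimelikeGrad T') (hT' : Differentiable ℝ T')
    (hle : ∀ q, T' q ≤ T q) {K : Set (M n)} (hK : IsCompact K)
    (heq : ∀ q ∉ K, T' q = T q) {x : ℝ → E n} (hx : LipschitzWith 1 x) :
    (∃ t : ℝ, (t, x t) ∈ T' ⁻¹' {0}) ↔ ∃ t : ℝ, (t, x t) ∈ T ⁻¹' {0} := by
  have hm := hTg.strictMono_curve hT hx
  have hm' := hTg'.strictMono_curve hT' hx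
  have hc : Continuous (fun t : ℝ => (t, x t)) := continuous_id.prodMk hx.continuous
  have hTc : Continuous (fun t => T (t, x t)) := hT.continuous.comp hc
  have hTc' : Continuous (fun t => T' (t, x t)) := hT'.continuous.comp hc
  obtain ⟨b, hb⟩ := (hK.image continuous_fst).bddAbove
  obtain ⟨a, ha⟩ := (hK.image continuous_fst).bddBelow
  constructor
  · rintro ⟨t, ht⟩
    have ht : T' (t, x t) = 0 := ht
    set s := min a t - 1
    have hs : s < t := by have := min_le_right a t; grind
    have hsK : (s, x s) ∉ K := fun h => by
      have h1 : a ≤ s := ha ⟨_, h, rfl⟩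
      have := min_le_left a t
      grind
    have h1 : T' (s, x s) < T' (t, x t) := hm' hs
    obtain ⟨u, -, hu⟩ := intermediate_value_Icc hs.le hTc.continuousOn
      (show (0 : ℝ) ∈ Icc (T (s, x s)) (T (t, x t)) from
        ⟨by rw [← heq _ hsK]; linarith, by linarith [hle (t, x t)]⟩)
    exact ⟨u, hu⟩
  · rintro ⟨t, ht⟩
    have ht : T (t, x t) = 0 := ht
    set s := max b t + 1
    have hs : t < s := by have := le_max_right b t; grind
    have hsK : (s, x s) ∉ K := fun h => by
      have h1 : s ≤ b := hb ⟨_, h, rfl⟩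
      have := le_max_left b t
      grind
    have h1 : T (t, x t) < T (s, x s) := hm hs
    obtain ⟨u, -, hu⟩ := intermediate_value_Icc hs.le hTc'.continuousOn
      (show (0 : ℝ) ∈ Icc (T' (t, x t)) (T' (s, x s)) from
        ⟨by linarith [hle (t, x t)], by rw [heq _ hsK]; linarith⟩)
    exact ⟨u, hu⟩

/-- Subtracting a small multiple of a `C¹` function vanishing outside a compact set
preserves timelike gradients. -/
theorem TimelikeGrad.exists_pos_sub_smul {T φ : M n → ℝ} (hTg : TimelikeGrad T)
    (hT : ContDiff ℝ 1 T) (hφ : ContDiff ℝ 1 φ) {K : Set (M n)} (hK : IsCompact K)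
    (hφK : ∀ q ∉ K, φ q = 0) :
    ∃ ε : ℝ, 0 < ε ∧ TimelikeGrad (fun q => T q - ε * φ q) := by
  set i := ContinuousLinearMap.inr ℝ ℝ (E n)
  set e : M n := ((1 : ℝ), (0 : E n))
  have hdT := hT.continuous_fderiv one_ne_zero
  have hdφ := hφ.continuous_fderiv one_ne_zero
  let m : M n → ℝ := fun p => fderiv ℝ T p e - ‖(fderiv ℝ T p).comp i‖
  let k : M n → ℝ := fun p => fderiv ℝ φ p e + ‖(fderiv ℝ φ p).comp i‖
  have hmpos : ∀ p, 0 < m p := fun p => sub_pos.2 (hTg p)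
  have hmc : Continuous m := by fun_prop
  have hkc : Continuous k := by fun_prop
  have hquot : Continuous (fun p => k p / m p) := hkc.div hmc fun p => (hmpos p).ne'
  obtain ⟨C, hC⟩ := hK.exists_bound_of_continuousOn hquot.continuousOn
  have hpos : 0 < |C| + 1 := by positivity
  refine ⟨(|C| + 1)⁻¹, inv_pos.2 hpos, fun p => ?_⟩
  set ε := (|C| + 1)⁻¹
  have hε : 0 < ε := inv_pos.2 hpos
  have hfd : fderiv ℝ (fun q => T q - ε * φ q) p = fderiv ℝ T p - ε • fderiv ℝ φ p := by
    have h1 := (hT.differentiable one_ne_zero p).hasFDerivAt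
    have h2 := (hφ.differentiable one_ne_zero p).hasFDerivAt
    exact (h1.sub (h2.const_mul ε)).fderiv
  have hkey : ε * k p < m p := by
    by_cases hp : p ∈ K
    · have h1 : k p / m p < |C| + 1 := by
        have := (le_abs_self _).trans (hC p hp)
        linarith [le_abs_self C]
      rw [div_lt_iff₀ (hmpos p)] at h1
      rwa [inv_mul_lt_iff₀ hpos]
    · have h0 : φ =ᶠ[nhds p] fun _ => (0 : ℝ) := by
        filter_upwards [hK.isClosed.isOpen_compl.mem_nhds hp] with q hq using hφK q hq
      have h1 : fderiv ℝ φ p = 0 := by rw [h0.fderiv_eq]; simp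
      simpa [k, h1] using hmpos p
  have hnorm : ‖(fderiv ℝ T p - ε • fderiv ℝ φ p).comp i‖ ≤
      ‖(fderiv ℝ T p).comp i‖ + ε * ‖(fderiv ℝ φ p).comp i‖ := by
    rw [ContinuousLinearMap.sub_comp, ContinuousLinearMap.smul_comp]
    refine (norm_sub_le _ _).trans ?_
    rw [norm_smul, Real.norm_of_nonneg hε.le]
  rw [hfd]
  refine hnorm.trans_lt ?_
  simp only [_root_.sub_apply, _root_.smul_apply, smul_eq_mul]
  simp only [k, m] at hkey
  linarith

/-- A compact set inside an open set admits a smooth cutoff that is one on it and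
vanishes outside a compact subset of the open set. -/
theorem exists_contDiff_cutoff {X U : Set (M n)} (hX : IsCompact X) (hU : IsOpen U)
    (hXU : X ⊆ U) :
    ∃ (φ : M n → ℝ) (K : Set (M n)), ContDiff ℝ (⊤ : ℕ∞) φ ∧ IsCompact K ∧ K ⊆ U ∧
      (∀ q ∉ K, φ q = 0) ∧ (∀ q ∈ X, φ q = 1) ∧ ∀ q, 0 ≤ φ q := by
  obtain ⟨K, hK, hXK, hKU⟩ := exists_compact_between hX hU hXU
  obtain ⟨f, hf0, hf1, hf⟩ := exists_contMDiffMap_zero_one_of_isClosed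
    (n := (⊤ : ℕ∞)) (modelWithCornersSelf ℝ (M n)) isOpen_interior.isClosed_compl hX.isClosed
    (disjoint_left.2 fun q hq hqX => hq (hXK hqX) : Disjoint (interior K)ᶜ X)
  exact ⟨f, K, f.contMDiff.contDiff, hK, hKU,
    fun q hq => hf0 fun h => hq (interior_subset h), fun q hq => hf1 hq, fun q => (hf q).1⟩

/-- Timeslices can be deformed: for compact `X ⊆ Σ = T⁻¹(0)` and open
`U ⊇ X`, there is a forward Cauchy evolution of `Σ` within `U` off `X`. -/
theorem stmt12 {n : ℕ} (hn : 0 < n) (T : M n → ℝ)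
    (hT : ContDiff ℝ (⊤ : ℕ∞) T) (hTg : TimelikeGrad T)
    (X U : Set (M n)) (hX : IsCompact X) (hXS : X ⊆ T ⁻¹' {0})
    (hU : IsOpen U) (hXU : X ⊆ U) :
    ∃ T' : M n → ℝ, ContDiff ℝ (⊤ : ℕ∞) T' ∧ TimelikeGrad T' ∧
      (∀ q, T' q ≤ T q) ∧
      (∀ q ∉ U, T' q = T q) ∧
      T' ⁻¹' {0} ∩ Iminus (T ⁻¹' {0}) = ∅ ∧
      Dom (T' ⁻¹' {0}) = Dom (T ⁻¹' {0}) ∧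
      T' ⁻¹' {0} ∩ T ⁻¹' {0} ∩ X = ∅ := by
  obtain ⟨φ, K, hφ, hK, hKU, hφK, hφX, hφ0⟩ := exists_contDiff_cutoff hX hU hXU
  have hle1 : (1 : WithTop ℕ∞) ≤ ((⊤ : ℕ∞) : WithTop ℕ∞) := by exact_mod_cast le_top
  obtain ⟨ε, hε, hTg'⟩ := hTg.exists_pos_sub_smul (hT.of_le hle1) (hφ.of_le hle1) hK hφK
  have hT' : ContDiff ℝ (⊤ : ℕ∞) (fun q => T q - ε * φ q) := hT.sub (contDiff_const.mul hφ)
  have hd : Differentiable ℝ T := (hT.of_le hle1).differentiable one_ne_zero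
  have hd' := (hT'.of_le hle1).differentiable one_ne_zero
  have hle : ∀ q, T q - ε * φ q ≤ T q := fun q =>
    sub_le_self _ (mul_nonneg hε.le (hφ0 q))
  have heq : ∀ q ∉ K, T q - ε * φ q = T q := fun q hq => by simp [hφK q hq]
  refine ⟨_, hT', hTg', hle, fun q hq => heq q fun h => hq (hKU h), ?_, ?_, ?_⟩
  · rw [eq_empty_iff_forall_notMem]
    rintro q ⟨hq, p, hp, hqp⟩
    have hq : T q - ε * φ q = 0 := hq
    have hp : T p = 0 := hp
    have hlt := hTg.lt_of_causal_s12 hd (le_of_lt hqp : causal q p)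
      (sub_pos.1 (dist_nonneg.trans_lt hqp))
    linarith [hle q]
  · ext p
    exact forall_congr' fun x => forall_congr' fun hx => forall_congr' fun _ =>
      exists_curve_mem_zero_iff hTg hd hTg' hd' hle hK heq hx
  · rw [eq_empty_iff_forall_notMem]
    rintro q ⟨⟨hq, hq0⟩, hqX⟩
    have hq : T q - ε * φ q = 0 := hq
    have hq0 : T q = 0 := hq0
    rw [hφX q hqX] at hq
    linarith


end
end
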